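/- arXiv:2405.15447 — 2 statements merged into one kernel-verified Lean document; each statement's English description precedes it below -/
import Mathlib

section
/- In the polynomial ring ℝ[a₀, b₀, a₁, b₁, a₂, b₂, a₃, b₃], let I be the ideal generated by the ten polynomials (1 + a₀)², (a₂ − 2)², (3 − a₂)² + b₂² − 1, (a₀ + 3)a₁ + 5 + (b₀ + 1)b₁, (a₃ − 3)a₂ + 5 + (b₂ + 1)b₃, a₁ + a₀ + a₃ + a₂, a₀² + b₀² − 1, (6 − 2a₃)a₂ + a₃² − 2b₂b₃ + b₃² − 10, a₁² − 2a₀a₁ − 2b₀b₁ + b₁² − 1, and (a₀ − a₂ − a₃ − 3)a₁ + (3 − a₀ + a₃)a₂ + (b₀ − b₂ − b₃ − 1)b₁ + (b₂ − b₀ − 1)b₃ − a₀a₃ − b₀b₂ − 26. Then the quotient ring ℝ[a₀, …, b₃]/I is a finite-dimensional ℝ-vector space of dimension 6. (Hence the configuration X = (−1, 0, −2, −1, 2, 0, 1, −1) of Stachel's extended double-Watt framework is a realization of multiplicity 6, i.e. it has flexion order 5 according to the paper's redefinition.) -/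
open MvPolynomial

/-- If two elements with nilpotent sum each satisfy `z * (5 * z + 2 + n) = 0` with `n` nilpotent,
then they vanish: both would be `-2 / 5` modulo nilpotents on the other branch. -/
theorem eq_zero_of_add_mem_nilradical {A : Type*} [CommRing A] [Algebra ℝ A] {y z n k : A}
    (hn : n ∈ nilradical A) (hk : k ∈ nilradical A)
    (hy : y * (5 * y + 2 + n) = 0) (hz : z * (5 * z + 2 + k) = 0)
    (hyz : y + z ∈ nilradical A) : y = 0 := by
  have unit_of_ne_zero : ∀ r : ℝ, r ≠ 0 → IsUnit (algebraMap ℝ A r) := fun r hr =>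
    (IsUnit.mk0 r hr).map _
  have hy4 : algebraMap ℝ A 4 * y ∈ nilradical A := by
    have key : algebraMap ℝ A 4 * y = n * -y + k * z + (y + z) * (2 - 5 * (y - z)) := by
      rw [map_ofNat]
      linear_combination hy - hz
    rw [key]
    exact add_mem (add_mem (Ideal.mul_mem_right _ _ hn) (Ideal.mul_mem_right _ _ hk))
      (Ideal.mul_mem_right _ _ hyz)
  have hy_mem : y ∈ nilradical A :=
    (Ideal.unit_mul_mem_iff_mem _ (unit_of_ne_zero 4 (by norm_num))).1 hy4
  have hunit : IsUnit (5 * y + 2 + n) := by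
    have hnil : IsNilpotent (5 * y + n) :=
      mem_nilradical.1 (add_mem (Ideal.mul_mem_left _ _ hy_mem) hn)
    have h := hnil.isUnit_add_left_of_commute (unit_of_ne_zero 2 (by norm_num)) (Commute.all _ _)
    rw [map_ofNat] at h
    convert h using 1
    ring
  exact hunit.mul_left_eq_zero.1 hy

/-- The positions of the second arm of a Watt mechanism near its initial position, as a function of
the displacement `(u, t)` of the first arm, up to the branch on which the second arm is
reflected. -/
theorem exists_nilpotent_watt_branch {A : Type*} [CommRing A] {u t v w : A}
    (hu : u ^ 2 = 0) (hut : 2 * u = t ^ 2)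
    (hfix : u * v + 2 * v - 2 * u + (t + 1) * w - t = 0) (harm : v ^ 2 + w ^ 2 + 2 * v = 0) :
    ∃ n ∈ nilradical A, (v + u + t ^ 3) * (5 * (v + u + t ^ 3) + 2 + n) = 0 ∧
      w = t + t ^ 2 + t ^ 3 - (2 + u) * (1 - t + t ^ 2 - t ^ 3) * (v + u + t ^ 3) := by
  have ht4 : t ^ 4 = 0 := by linear_combination -(t ^ 2 + 2 * u) * hut + 4 * hu
  have hut2 : u * t ^ 2 = 0 := by linear_combination 2 * hu - u * hut
  have ht : t ∈ nilradical A := mem_nilradical.2 ⟨4, ht4⟩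
  have hu' : u ∈ nilradical A := mem_nilradical.2 ⟨2, hu⟩
  have hw : w = t + t ^ 2 + t ^ 3 - (2 + u) * (1 - t + t ^ 2 - t ^ 3) * (v + u + t ^ 3) := by
    linear_combination (1 - t + t ^ 2 - t ^ 3) * (hfix + 2 * hut + hu + t * hut2) +
      (w - (t + t ^ 2 + t ^ 3) - (1 - t + t ^ 2 - t ^ 3)) * ht4
  set z := v + u + t ^ 3 with hz
  set c := (2 + u) * (1 - t + t ^ 2 - t ^ 3) with hc
  refine ⟨(c ^ 2 - 4) * z - 2 * u - 2 * t ^ 3 - 2 * c * (t + t ^ 2 + t ^ 3), ?_, ?_, hw⟩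
  · have : (c ^ 2 - 4) * z - 2 * u - 2 * t ^ 3 - 2 * c * (t + t ^ 2 + t ^ 3) =
        u * ((c + 2) * z * (1 - t + t ^ 2 - t ^ 3) - 2) +
          t * ((c + 2) * z * 2 * (-1 + t - t ^ 2) - 2 * t ^ 2 - 2 * c * (1 + t + t ^ 2)) := by
      rw [hc]; ring
    rw [this]
    exact add_mem (Ideal.mul_mem_right _ _ hu') (Ideal.mul_mem_right _ _ ht)
  · have hv : v = z - u - t ^ 3 := by rw [hz]; ring
    rw [hw, hv] at harm
    clear_value z c
    linear_combination harm - hu - 2 * t * hut2 + hut - (3 + 2 * t + 2 * t ^ 2) * ht4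

theorem relations_of_curve {A : Type*} [CommRing A] [IsAddTorsionFree A] {s t : A} (ht : t ^ 4 = 0)
    (hst : s ^ 3 + t ^ 3 = 0)
    (h : 2 * (s - t) ^ 2 = 2 * s * t * (s + t) + s ^ 2 * t ^ 2 + 12 * t ^ 3) :
    3 * ((s - t) * t ^ 2) = -2 * t ^ 3 ∧ (s - t) ^ 2 = 6 * t ^ 3 := by
  constructor <;> grind

/-- The local algebra `ℝ[t, y] / (t ^ 4, y ^ 2 - 6 t ^ 3, y t ^ 2 + (2 / 3) t ^ 3)`, written in the
basis `1, t, t ^ 2, t ^ 3, y, y t`. -/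
def WattAlgebra : Type := Fin 6 → ℝ

namespace WattAlgebra

noncomputable instance : AddCommGroup WattAlgebra := inferInstanceAs (AddCommGroup (Fin 6 → ℝ))

noncomputable instance : Module ℝ WattAlgebra := inferInstanceAs (Module ℝ (Fin 6 → ℝ))

noncomputable instance : Mul WattAlgebra where
  mul a b := ![a 0 * b 0, a 0 * b 1 + a 1 * b 0, a 0 * b 2 + a 1 * b 1 + a 2 * b 0,
    a 0 * b 3 + a 1 * b 2 + a 2 * b 1 + a 3 * b 0 + 6 * (a 4 * b 4) -
      2 / 3 * (a 4 * b 2 + a 2 * b 4 + a 5 * b 1 + a 1 * b 5),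
    a 0 * b 4 + a 4 * b 0, a 0 * b 5 + a 5 * b 0 + a 4 * b 1 + a 1 * b 4]

noncomputable instance : One WattAlgebra where
  one := ![1, 0, 0, 0, 0, 0]

theorem add_apply (a b : WattAlgebra) (i : Fin 6) : (a + b) i = a i + b i := rfl

theorem zero_apply (i : Fin 6) : (0 : WattAlgebra) i = 0 := rfl

theorem smul_apply (r : ℝ) (a : WattAlgebra) (i : Fin 6) : (r • a) i = r * a i := rfl

theorem one_apply (i : Fin 6) : (1 : WattAlgebra) i = ![(1 : ℝ), 0, 0, 0, 0, 0] i := rfl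

theorem mul_apply (a b : WattAlgebra) (i : Fin 6) : (a * b) i =
    ![a 0 * b 0, a 0 * b 1 + a 1 * b 0, a 0 * b 2 + a 1 * b 1 + a 2 * b 0,
      a 0 * b 3 + a 1 * b 2 + a 2 * b 1 + a 3 * b 0 + 6 * (a 4 * b 4) -
        2 / 3 * (a 4 * b 2 + a 2 * b 4 + a 5 * b 1 + a 1 * b 5),
      a 0 * b 4 + a 4 * b 0, a 0 * b 5 + a 5 * b 0 + a 4 * b 1 + a 1 * b 4] i := rfl

@[ext]
theorem ext {a b : WattAlgebra} (h : ∀ i, a i = b i) : a = b := funext h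

noncomputable instance : CommRing WattAlgebra where
  __ := (inferInstance : AddCommGroup WattAlgebra)
  left_distrib a b c := by ext i; fin_cases i <;> simp [mul_apply, add_apply] <;> ring
  right_distrib a b c := by ext i; fin_cases i <;> simp [mul_apply, add_apply] <;> ring
  zero_mul a := by ext i; fin_cases i <;> simp [mul_apply, zero_apply]
  mul_zero a := by ext i; fin_cases i <;> simp [mul_apply, zero_apply]
  mul_assoc a b c := by ext i; fin_cases i <;> simp [mul_apply] <;> ring
  one_mul a := by ext i; fin_cases i <;> simp [mul_apply, one_apply]
  mul_one a := by ext i; fin_cases i <;> simp [mul_apply, one_apply]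
  mul_comm a b := by ext i; fin_cases i <;> simp [mul_apply] <;> ring

noncomputable instance : Algebra ℝ WattAlgebra :=
  Algebra.ofModule
    (fun r a b => by ext i; fin_cases i <;> simp [mul_apply, smul_apply] <;> ring)
    (fun r a b => by ext i; fin_cases i <;> simp [mul_apply, smul_apply] <;> ring)

instance : FiniteDimensional ℝ WattAlgebra := inferInstanceAs (FiniteDimensional ℝ (Fin 6 → ℝ))

theorem finrank_eq : Module.finrank ℝ WattAlgebra = 6 :=
  Module.finrank_fin_fun ℝ

/-- The generator `t` of `WattAlgebra`. -/
noncomputable def t : WattAlgebra := ![0, 1, 0, 0, 0, 0]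

/-- The generator `y` of `WattAlgebra`. -/
noncomputable def y : WattAlgebra := ![0, 0, 0, 0, 1, 0]

theorem t_apply (i : Fin 6) : t i = ![(0 : ℝ), 1, 0, 0, 0, 0] i := rfl

theorem y_apply (i : Fin 6) : y i = ![(0 : ℝ), 0, 0, 0, 1, 0] i := rfl

theorem t_sq_apply (i : Fin 6) : (t ^ 2) i = ![(0 : ℝ), 0, 1, 0, 0, 0] i := by
  rw [pow_two]; fin_cases i <;> simp [mul_apply, t_apply]

theorem t_cube_apply (i : Fin 6) : (t ^ 3) i = ![(0 : ℝ), 0, 0, 1, 0, 0] i := by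
  rw [pow_succ]; fin_cases i <;> simp [mul_apply, t_apply, t_sq_apply]

theorem t_pow_four : t ^ 4 = 0 := by
  rw [pow_succ]; ext i; fin_cases i <;> simp [mul_apply, t_apply, t_cube_apply, zero_apply]

theorem y_mul_t_apply (i : Fin 6) : (y * t) i = ![(0 : ℝ), 0, 0, 0, 0, 1] i := by
  fin_cases i <;> simp [mul_apply, t_apply, y_apply]

theorem y_sq : y ^ 2 = (6 : ℝ) • t ^ 3 := by
  rw [pow_two]; ext i; fin_cases i <;> simp [mul_apply, y_apply, t_cube_apply, smul_apply]

theorem y_mul_t_sq : y * t ^ 2 = (-2 / 3 : ℝ) • t ^ 3 := by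
  ext i
  fin_cases i <;> simp [mul_apply, y_apply, t_sq_apply, t_cube_apply, smul_apply]
  norm_num

theorem eq_sum (a : WattAlgebra) :
    a = a 0 • 1 + a 1 • t + a 2 • t ^ 2 + a 3 • t ^ 3 + a 4 • y + a 5 • (y * t) := by
  ext i
  fin_cases i <;> simp [add_apply, smul_apply, one_apply, t_apply, y_apply, t_sq_apply,
    t_cube_apply, y_mul_t_apply]

/-- The universal property of `WattAlgebra`. -/
noncomputable def lift {A : Type*} [CommRing A] [Algebra ℝ A] (t y : A) (ht : t ^ 4 = 0)
    (hy : y ^ 2 = (6 : ℝ) • t ^ 3) (hyt : y * t ^ 2 = (-2 / 3 : ℝ) • t ^ 3) :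
    WattAlgebra →ₐ[ℝ] A :=
  AlgHom.ofLinearMap
    { toFun := fun a =>
        a 0 • 1 + a 1 • t + a 2 • t ^ 2 + a 3 • t ^ 3 + a 4 • y + a 5 • (y * t)
      map_add' := fun a b => by simp only [add_apply, add_smul]; abel
      map_smul' := fun r a => by simp only [smul_apply, mul_smul, smul_add, RingHom.id_apply] }
    (by simp [one_apply])
    (fun a b => by
      simp only [Algebra.smul_def] at hy hyt
      simp only [LinearMap.coe_mk, AddHom.coe_mk, mul_apply, Algebra.smul_def]
      simp only [Matrix.cons_val, map_add, map_sub, map_mul, mul_one]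
      rw [neg_div, map_neg] at hyt
      set c := algebraMap ℝ A
      linear_combination
        -(c (a 4) * c (b 2) + c (a 2) * c (b 4) + c (a 5) * c (b 1) + c (a 1) * c (b 5) +
            (c (a 4) * c (b 3) + c (a 3) * c (b 4) + c (a 5) * c (b 2) + c (a 2) * c (b 5)) * t) *
            hyt -
          (c (a 4) * c (b 4) + (c (a 4) * c (b 5) + c (a 5) * c (b 4)) * t +
            c (a 5) * c (b 5) * t ^ 2) * hy -
          (c (a 1) * c (b 3) + c (a 2) * c (b 2) + c (a 3) * c (b 1) +
            (c (a 2) * c (b 3) + c (a 3) * c (b 2)) * t + c (a 3) * c (b 3) * t ^ 2 -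
            c (2 / 3) *
              (c (a 4) * c (b 3) + c (a 3) * c (b 4) + c (a 5) * c (b 2) + c (a 2) * c (b 5)) +
            (c (a 5) * c (b 3) + c (a 3) * c (b 5)) * y +
            c 6 * (c (a 4) * c (b 5) + c (a 5) * c (b 4) + c (a 5) * c (b 5) * t)) * ht)

theorem lift_apply {A : Type*} [CommRing A] [Algebra ℝ A] (t y : A) (ht : t ^ 4 = 0)
    (hy : y ^ 2 = (6 : ℝ) • t ^ 3) (hyt : y * t ^ 2 = (-2 / 3 : ℝ) • t ^ 3) (a : WattAlgebra) :
    lift t y ht hy hyt a =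
      a 0 • 1 + a 1 • t + a 2 • t ^ 2 + a 3 • t ^ 3 + a 4 • y + a 5 • (y * t) := rfl

theorem lift_t {A : Type*} [CommRing A] [Algebra ℝ A] (t y : A) (ht : t ^ 4 = 0)
    (hy : y ^ 2 = (6 : ℝ) • t ^ 3) (hyt : y * t ^ 2 = (-2 / 3 : ℝ) • t ^ 3) :
    lift t y ht hy hyt WattAlgebra.t = t := by
  simp [lift_apply, t_apply]

theorem lift_y {A : Type*} [CommRing A] [Algebra ℝ A] (t y : A) (ht : t ^ 4 = 0)
    (hy : y ^ 2 = (6 : ℝ) • t ^ 3) (hyt : y * t ^ 2 = (-2 / 3 : ℝ) • t ^ 3) :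
    lift t y ht hy hyt WattAlgebra.y = y := by
  simp [lift_apply, y_apply]

theorem algHom_ext {A : Type*} [CommRing A] [Algebra ℝ A] {f g : WattAlgebra →ₐ[ℝ] A}
    (ht : f t = g t) (hy : f y = g y) : f = g := by
  ext a
  rw [eq_sum a]
  simp only [map_add, map_smul, map_one, map_pow, map_mul, ht, hy]

end WattAlgebra

/-- The defining equations of the primary component at the initial configuration of the extended
double-Watt framework. -/
structure IsWattConfiguration {A : Type*} [CommRing A] (a₀ b₀ a₁ b₁ a₂ b₂ a₃ b₃ : A) : Prop where
  a₀_sq : (1 + a₀) ^ 2 = 0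
  a₂_sq : (a₂ - 2) ^ 2 = 0
  arm₂ : (3 - a₂) ^ 2 + b₂ ^ 2 - 1 = 0
  coupler₀₁ : (a₀ + 3) * a₁ + 5 + (b₀ + 1) * b₁ = 0
  coupler₂₃ : (a₃ - 3) * a₂ + 5 + (b₂ + 1) * b₃ = 0
  guidance : a₁ + a₀ + a₃ + a₂ = 0
  arm₀ : a₀ ^ 2 + b₀ ^ 2 - 1 = 0
  arm₃ : (6 - 2 * a₃) * a₂ + a₃ ^ 2 - 2 * b₂ * b₃ + b₃ ^ 2 - 10 = 0
  arm₁ : a₁ ^ 2 - 2 * a₀ * a₁ - 2 * b₀ * b₁ + b₁ ^ 2 - 1 = 0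
  bar : (a₀ - a₂ - a₃ - 3) * a₁ + (3 - a₀ + a₃) * a₂ + (b₀ - b₂ - b₃ - 1) * b₁ +
    (b₂ - b₀ - 1) * b₃ - a₀ * a₃ - b₀ * b₂ - 26 = 0

/-- In displacements `x, s, p, q, u, t, v, w` from the initial configuration, both Watt mechanisms
stay on the branch through that configuration. -/
theorem eq_of_displacements {A : Type*} [CommRing A] [Algebra ℝ A] {x s p q u t v w : A}
    (hx : x ^ 2 = 0) (hxs : 2 * x = s ^ 2) (hu : u ^ 2 = 0) (hut : 2 * u = t ^ 2)
    (hxp : x * p + 2 * p - 2 * x + (s + 1) * q - s = 0) (hpq : p ^ 2 + q ^ 2 + 2 * p = 0)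
    (huv : u * v + 2 * v - 2 * u + (t + 1) * w - t = 0) (hvw : v ^ 2 + w ^ 2 + 2 * v = 0)
    (hsum : x + p + u + v = 0) :
    s ^ 3 + t ^ 3 = 0 ∧ p = -x - s ^ 3 ∧ q = s + s ^ 2 + s ^ 3 ∧
      v = -u - t ^ 3 ∧ w = t + t ^ 2 + t ^ 3 := by
  obtain ⟨n, hn, hpn, hq⟩ := exists_nilpotent_watt_branch hx hxs hxp hpq
  obtain ⟨k, hk, hvk, hw⟩ := exists_nilpotent_watt_branch hu hut huv hvw
  have hs : s ∈ nilradical A :=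
    mem_nilradical.2 ⟨4, by linear_combination -(s ^ 2 + 2 * x) * hxs + 4 * hx⟩
  have ht : t ∈ nilradical A :=
    mem_nilradical.2 ⟨4, by linear_combination -(t ^ 2 + 2 * u) * hut + 4 * hu⟩
  have hadd : (p + x + s ^ 3) + (v + u + t ^ 3) = s ^ 3 + t ^ 3 := by linear_combination hsum
  have hnil : s ^ 3 + t ^ 3 ∈ nilradical A :=
    add_mem (Ideal.pow_mem_of_mem _ hs 3 three_pos) (Ideal.pow_mem_of_mem _ ht 3 three_pos)
  have hp0 := eq_zero_of_add_mem_nilradical hn hk hpn hvk (hadd ▸ hnil)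
  have hv0 := eq_zero_of_add_mem_nilradical hk hn hvk hpn (by rwa [add_comm, hadd])
  rw [hp0, mul_zero, sub_zero] at hq
  rw [hv0, mul_zero, sub_zero] at hw
  refine ⟨by rw [← hadd, hp0, hv0, add_zero], ?_, hq, ?_, hw⟩
  · linear_combination hp0
  · linear_combination hv0

namespace IsWattConfiguration

variable {A : Type*} [CommRing A] {a₀ b₀ a₁ b₁ a₂ b₂ a₃ b₃ : A}

theorem b₂_pow_four (h : IsWattConfiguration a₀ b₀ a₁ b₁ a₂ b₂ a₃ b₃) : b₂ ^ 4 = 0 := by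
  have h2 : b₂ ^ 2 = 2 * (a₂ - 2) := by linear_combination h.arm₂ - h.a₂_sq
  linear_combination (b₂ ^ 2 + 2 * (a₂ - 2)) * h2 + 4 * h.a₂_sq

variable [Algebra ℝ A]

theorem arms_eq (h : IsWattConfiguration a₀ b₀ a₁ b₁ a₂ b₂ a₃ b₃) :
    b₀ ^ 3 + b₂ ^ 3 = 0 ∧ a₁ + 2 = -(a₀ + 1) - b₀ ^ 3 ∧ b₁ + 1 = b₀ + b₀ ^ 2 + b₀ ^ 3 ∧
      a₃ - 1 = -(a₂ - 2) - b₂ ^ 3 ∧ b₃ + 1 = b₂ + b₂ ^ 2 + b₂ ^ 3 := by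
  apply eq_of_displacements
  · linear_combination h.a₀_sq
  · linear_combination h.a₀_sq - h.arm₀
  · exact h.a₂_sq
  · linear_combination h.a₂_sq - h.arm₂
  · linear_combination h.coupler₀₁
  · linear_combination h.arm₁ + 2 * h.coupler₀₁
  · linear_combination h.coupler₂₃
  · linear_combination h.arm₃ + 2 * h.coupler₂₃
  · linear_combination h.guidance

theorem relations (h : IsWattConfiguration a₀ b₀ a₁ b₁ a₂ b₂ a₃ b₃) :
    (b₀ - b₂) ^ 2 = (6 : ℝ) • b₂ ^ 3 ∧ (b₀ - b₂) * b₂ ^ 2 = (-2 / 3 : ℝ) • b₂ ^ 3 := by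
  have := IsAddTorsionFree.of_isTorsionFree ℝ A
  obtain ⟨hst, ha₁, hb₁, ha₃, hb₃⟩ := h.arms_eq
  have ht := h.b₂_pow_four
  have hs2 : b₀ ^ 2 = 2 * (a₀ + 1) := by linear_combination h.arm₀ - h.a₀_sq
  have ht2 : b₂ ^ 2 = 2 * (a₂ - 2) := by linear_combination h.arm₂ - h.a₂_sq
  have hcurve : 2 * (b₀ - b₂) ^ 2 =
      2 * b₀ * b₂ * (b₀ + b₂) + b₀ ^ 2 * b₂ ^ 2 + 12 * b₂ ^ 3 := by
    have hbar := h.bar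
    rw [show a₁ = -(a₀ + 1) - b₀ ^ 3 - 2 by linear_combination ha₁,
      show b₁ = b₀ + b₀ ^ 2 + b₀ ^ 3 - 1 by linear_combination hb₁,
      show a₃ = -(a₂ - 2) - b₂ ^ 3 + 1 by linear_combination ha₃,
      show b₃ = b₂ + b₂ ^ 2 + b₂ ^ 3 - 1 by linear_combination hb₃] at hbar
    have hx := h.a₀_sq
    have hu := h.a₂_sq
    grind
  obtain ⟨hyt, hy⟩ := relations_of_curve ht hst hcurve
  refine ⟨by rw [hy, Algebra.smul_def, map_ofNat], ?_⟩
  rw [neg_div, neg_smul, div_eq_inv_mul, mul_smul, ← smul_neg, eq_inv_smul_iff₀ three_ne_zero]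
  simp only [Algebra.smul_def, map_ofNat]
  linear_combination hyt

/-- The coordinates of a configuration as polynomials in `t = b₂` and `y = b₀ - b₂`. -/
theorem eq_coordinates (h : IsWattConfiguration a₀ b₀ a₁ b₁ a₂ b₂ a₃ b₃) :
    a₀ = -1 + (b₀ - b₂) * b₂ + (1 / 2 : ℝ) • b₂ ^ 2 + (3 : ℝ) • b₂ ^ 3 ∧
      a₁ = -2 - (b₀ - b₂) * b₂ - (1 / 2 : ℝ) • b₂ ^ 2 - (2 : ℝ) • b₂ ^ 3 ∧
      b₁ = -1 + (b₀ - b₂) + b₂ + (2 : ℝ) • ((b₀ - b₂) * b₂) + b₂ ^ 2 + (5 : ℝ) • b₂ ^ 3 ∧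
      a₂ = 2 + (1 / 2 : ℝ) • b₂ ^ 2 ∧
      a₃ = 1 - (1 / 2 : ℝ) • b₂ ^ 2 - b₂ ^ 3 ∧ b₃ = -1 + b₂ + b₂ ^ 2 + b₂ ^ 3 := by
  have := IsAddTorsionFree.of_isTorsionFree ℝ A
  obtain ⟨hst, ha₁, hb₁, ha₃, hb₃⟩ := h.arms_eq
  have hy := h.relations.1
  have hs2 : b₀ ^ 2 = 2 * (a₀ + 1) := by linear_combination h.arm₀ - h.a₀_sq
  have ht2 : b₂ ^ 2 = 2 * (a₂ - 2) := by linear_combination h.arm₂ - h.a₂_sq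
  have hhalf : 2 * ((1 / 2 : ℝ) • b₂ ^ 2) = b₂ ^ 2 := by
    rw [two_mul, ← add_smul]; norm_num
  simp only [Algebra.smul_def _ (b₂ ^ 3), Algebra.smul_def _ ((b₀ - b₂) * b₂), map_ofNat] at hy ⊢
  have hu : a₂ = 2 + (1 / 2 : ℝ) • b₂ ^ 2 := by grind
  have hx : a₀ = -1 + (b₀ - b₂) * b₂ + (1 / 2 : ℝ) • b₂ ^ 2 + 3 * b₂ ^ 3 := by grind
  exact ⟨hx, by linear_combination ha₁ - hx - hst, by linear_combination hb₁ + hy + hst, hu,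
    by linear_combination ha₃ - hu, by linear_combination hb₃⟩

end IsWattConfiguration

/-- The configuration with coordinates in `WattAlgebra` that is universal among all
configurations. -/
noncomputable def WattAlgebra.point : Fin 8 → WattAlgebra :=
  open WattAlgebra in
  ![-1 + y * t + (1 / 2 : ℝ) • t ^ 2 + (3 : ℝ) • t ^ 3, y + t,
    -2 - y * t - (1 / 2 : ℝ) • t ^ 2 - (2 : ℝ) • t ^ 3,
    -1 + y + t + (2 : ℝ) • (y * t) + t ^ 2 + (5 : ℝ) • t ^ 3,
    2 + (1 / 2 : ℝ) • t ^ 2, t, 1 - (1 / 2 : ℝ) • t ^ 2 - t ^ 3, -1 + t + t ^ 2 + t ^ 3]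

theorem WattAlgebra.isWattConfiguration_point :
    IsWattConfiguration (point 0) (point 1) (point 2) (point 3) (point 4) (point 5) (point 6)
      (point 7) := by
  have := IsAddTorsionFree.of_isTorsionFree ℝ WattAlgebra
  have ht := t_pow_four
  have hy := y_sq
  have hyt := y_mul_t_sq
  have hhalf : 2 * ((1 / 2 : ℝ) • t ^ 2) = t ^ 2 := by
    rw [two_mul, ← add_smul]; norm_num
  have hyt' : 3 * (y * t ^ 2) = -2 * t ^ 3 := by
    rw [hyt, ← map_ofNat (algebraMap ℝ WattAlgebra) 3, ← Algebra.smul_def, smul_smul,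
      ← map_ofNat (algebraMap ℝ WattAlgebra) 2, ← map_neg, ← Algebra.smul_def]
    norm_num
  simp only [point, Matrix.cons_val, Algebra.smul_def _ (t ^ 3), Algebra.smul_def _ (y * t),
    map_ofNat] at hy ⊢
  generalize (1 / 2 : ℝ) • t ^ 2 = u at *
  generalize t = t at *
  generalize y = y at *
  clear hyt
  constructor <;> grind

/-- Stachel's extended double-Watt framework: the quotient of
`ℝ[a₀, b₀, a₁, b₁, a₂, b₂, a₃, b₃]` by the zero-dimensional primary ideal `I`
(whose sole zero is the configuration `X = (-1, 0, -2, -1, 2, 0, 1, -1)`) is a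
`6`-dimensional `ℝ`-vector space, so `X` is a realization of multiplicity `6`,
i.e. it has flexion order `5`. -/
theorem stachel_doubleWatt_multiplicity_six :
    let a₀ : MvPolynomial (Fin 8) ℝ := X 0
    let b₀ : MvPolynomial (Fin 8) ℝ := X 1
    let a₁ : MvPolynomial (Fin 8) ℝ := X 2
    let b₁ : MvPolynomial (Fin 8) ℝ := X 3
    let a₂ : MvPolynomial (Fin 8) ℝ := X 4
    let b₂ : MvPolynomial (Fin 8) ℝ := X 5
    let a₃ : MvPolynomial (Fin 8) ℝ := X 6
    let b₃ : MvPolynomial (Fin 8) ℝ := X 7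
    let I : Ideal (MvPolynomial (Fin 8) ℝ) :=
      Ideal.span {(1 + a₀) ^ 2, (a₂ - 2) ^ 2, (3 - a₂) ^ 2 + b₂ ^ 2 - 1,
        (a₀ + 3) * a₁ + 5 + (b₀ + 1) * b₁,
        (a₃ - 3) * a₂ + 5 + (b₂ + 1) * b₃,
        a₁ + a₀ + a₃ + a₂,
        a₀ ^ 2 + b₀ ^ 2 - 1,
        (6 - 2 * a₃) * a₂ + a₃ ^ 2 - 2 * b₂ * b₃ + b₃ ^ 2 - 10,
        a₁ ^ 2 - 2 * a₀ * a₁ - 2 * b₀ * b₁ + b₁ ^ 2 - 1,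
        (a₀ - a₂ - a₃ - 3) * a₁ + (3 - a₀ + a₃) * a₂ +
          (b₀ - b₂ - b₃ - 1) * b₁ + (b₂ - b₀ - 1) * b₃ -
          a₀ * a₃ - b₀ * b₂ - 26}
    FiniteDimensional ℝ (MvPolynomial (Fin 8) ℝ ⧸ I) ∧
      Module.finrank ℝ (MvPolynomial (Fin 8) ℝ ⧸ I) = 6 := by
  intro a₀ b₀ a₁ b₁ a₂ b₂ a₃ b₃ I
  let π : MvPolynomial (Fin 8) ℝ →ₐ[ℝ] MvPolynomial (Fin 8) ℝ ⧸ I := Ideal.Quotient.mkₐ ℝ I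
  have hI : ∀ {A : Type} [CommRing A] [Algebra ℝ A] (f : MvPolynomial (Fin 8) ℝ →ₐ[ℝ] A),
      I ≤ RingHom.ker f ↔ IsWattConfiguration (f a₀) (f b₀) (f a₁) (f b₁) (f a₂) (f b₂) (f a₃)
        (f b₃) := by
    intro A _ _ f
    simp only [I, Ideal.span_le, Set.insert_subset_iff, Set.singleton_subset_iff, SetLike.mem_coe,
      RingHom.mem_ker, map_add, map_sub, map_mul, map_pow, map_ofNat, map_one]
    exact ⟨fun ⟨h₁, h₂, h₃, h₄, h₅, h₆, h₇, h₈, h₉, h₁₀⟩ =>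
        ⟨h₁, h₂, h₃, h₄, h₅, h₆, h₇, h₈, h₉, h₁₀⟩,
      fun ⟨h₁, h₂, h₃, h₄, h₅, h₆, h₇, h₈, h₉, h₁₀⟩ =>
        ⟨h₁, h₂, h₃, h₄, h₅, h₆, h₇, h₈, h₉, h₁₀⟩⟩
  have hπ := (hI π).1 (Ideal.mk_ker (I := I)).ge
  have hpoint : I ≤ RingHom.ker (aeval (R := ℝ) WattAlgebra.point) := by
    rw [hI]
    simpa only [a₀, b₀, a₁, b₁, a₂, b₂, a₃, b₃, aeval_X] using
      WattAlgebra.isWattConfiguration_point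
  let toWatt : (MvPolynomial (Fin 8) ℝ ⧸ I) →ₐ[ℝ] WattAlgebra :=
    Ideal.Quotient.liftₐ I (aeval WattAlgebra.point) hpoint
  let ofWatt : WattAlgebra →ₐ[ℝ] (MvPolynomial (Fin 8) ℝ ⧸ I) :=
    WattAlgebra.lift (π b₂) (π b₀ - π b₂) hπ.b₂_pow_four hπ.relations.1 hπ.relations.2
  have htoWatt : ∀ i, toWatt (π (X i)) = WattAlgebra.point i := fun i => aeval_X _ i
  have hleft : toWatt.comp ofWatt = AlgHom.id ℝ WattAlgebra := by
    apply WattAlgebra.algHom_ext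
    · simp [ofWatt, WattAlgebra.lift_t, b₂, htoWatt, WattAlgebra.point]
    · simp [ofWatt, WattAlgebra.lift_y, b₀, b₂, htoWatt, WattAlgebra.point]
  have hright : ofWatt.comp toWatt = AlgHom.id ℝ (MvPolynomial (Fin 8) ℝ ⧸ I) := by
    apply Ideal.Quotient.algHom_ext
    apply MvPolynomial.algHom_ext
    intro i
    change ofWatt (toWatt (π (X i))) = π (X i)
    obtain ⟨ha₀, ha₁, hb₁, ha₂, ha₃, hb₃⟩ := hπ.eq_coordinates
    rw [htoWatt]
    fin_cases i <;>
      simp only [WattAlgebra.point, map_add, map_sub, map_neg, map_mul, map_pow, map_smul, map_one,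
        map_ofNat, ofWatt, WattAlgebra.lift_t, WattAlgebra.lift_y, Fin.reduceFinMk,
        Matrix.cons_val]
    · exact ha₀.symm
    · exact sub_add_cancel _ _
    · exact ha₁.symm
    · exact hb₁.symm
    · exact ha₂.symm
    · rfl
    · exact ha₃.symm
    · exact hb₃.symm
  let e : (MvPolynomial (Fin 8) ℝ ⧸ I) ≃ₐ[ℝ] WattAlgebra :=
    AlgEquiv.ofAlgHom toWatt ofWatt hleft hright
  exact ⟨e.symm.toLinearEquiv.finiteDimensional,
    e.toLinearEquiv.finrank_eq.trans WattAlgebra.finrank_eq⟩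
end

section
/- Consider the planar 3-RPR manipulator interpreted as a bar-joint framework, with variables (A₃, B₃, a₁, b₁, a₂, b₂, a₃, b₃) ∈ ℝ⁸, base points M₁ = (0,0), M₂ = (1,0), M₃ = (A₃, B₃), platform points mⱼ = (aⱼ, bⱼ) for j = 1,2,3, and the eight squared-distance constraint functions d₁ = A₃² + B₃², d₂ = (A₃ − 1)² + B₃², d₃ = (a₂ − a₁)² + (b₂ − b₁)², d₄ = (a₃ − a₁)² + (b₃ − b₁)², d₅ = (a₃ − a₂)² + (b₃ − b₂)², d₆ = a₁² + b₁², d₇ = (a₂ − 1)² + b₂², d₈ = (a₃ − A₃)² + (b₃ − B₃)². Let J be the 8×8 matrix of partial derivatives of the dᵢ with respect to the eight variables. Then there exists a nonzero rational constant c such that det J = c · s₁ · s₂ · s₃ as polynomials, where s₁ = B₃, s₂ = a₁b₂ − a₁b₃ − a₂b₁ + a₂b₃ + a₃b₁ − a₃b₂, and s₃ = A₃a₁b₂b₃ − A₃a₂b₁b₃ − B₃a₁a₃b₂ + B₃a₂a₃b₁ − A₃b₁b₂ + A₃b₁b₃ + B₃a₁b₂ − B₃a₃b₁ − a₁b₂b₃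 + a₃b₁b₂. -/
open MvPolynomial

set_option maxHeartbeats 1000000 in
/-- The determinant of the transposed rigidity matrix of the planar 3-RPR bar-joint framework,
over an arbitrary commutative ring. -/
theorem det_threeRPR_rigidity {R : Type*} [CommRing R] (A₃ B₃ a₁ b₁ a₂ b₂ a₃ b₃ : R) :
    (!![2 * A₃, 2 * (A₃ - 1), 0, 0, 0, 0, 0, 2 * (A₃ - a₃);
        2 * B₃, 2 * B₃, 0, 0, 0, 0, 0, 2 * (B₃ - b₃);
        0, 0, 2 * (a₁ - a₂), 2 * (a₁ - a₃), 0, 2 * a₁, 0, 0;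
        0, 0, 2 * (b₁ - b₂), 2 * (b₁ - b₃), 0, 2 * b₁, 0, 0;
        0, 0, 2 * (a₂ - a₁), 0, 2 * (a₂ - a₃), 0, 2 * (a₂ - 1), 0;
        0, 0, 2 * (b₂ - b₁), 0, 2 * (b₂ - b₃), 0, 2 * b₂, 0;
        0, 0, 0, 2 * (a₃ - a₁), 2 * (a₃ - a₂), 0, 0, 2 * (a₃ - A₃);
        0, 0, 0, 2 * (b₃ - b₁), 2 * (b₃ - b₂), 0, 0, 2 * (b₃ - B₃)] :
      Matrix (Fin 8) (Fin 8) R).det =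
      256 * (B₃ *
        (a₁ * b₂ - a₁ * b₃ - a₂ * b₁ + a₂ * b₃ + a₃ * b₁ - a₃ * b₂) *
        (A₃ * a₁ * b₂ * b₃ - A₃ * a₂ * b₁ * b₃ - B₃ * a₁ * a₃ * b₂ +
          B₃ * a₂ * a₃ * b₁ - A₃ * b₁ * b₂ + A₃ * b₁ * b₃ + B₃ * a₁ * b₂ -
          B₃ * a₃ * b₁ - a₁ * b₂ * b₃ + a₃ * b₁ * b₂)) := by
  simp [Matrix.det_succ_column_zero, Fin.sum_univ_succ, Fin.succAbove]
  ring

/-- The determinant of the rigidity matrix of the planar 3-RPR manipulator,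
interpreted as a bar-joint framework, factors (up to a nonzero rational
constant) into `s₁ · s₂ · s₃`, where `s₁ = 0` means the base degenerates into a
line, `s₂ = 0` means the platform degenerates into a line, and `s₃ = 0` means
the three legs belong to a pencil of lines. -/
theorem threeRPR_barJoint_rigidity_det_factors :
    let A₃ : MvPolynomial (Fin 8) ℝ := X 0
    let B₃ : MvPolynomial (Fin 8) ℝ := X 1
    let a₁ : MvPolynomial (Fin 8) ℝ := X 2
    let b₁ : MvPolynomial (Fin 8) ℝ := X 3
    let a₂ : MvPolynomial (Fin 8) ℝ := X 4
    let b₂ : MvPolynomial (Fin 8) ℝ := X 5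
    let a₃ : MvPolynomial (Fin 8) ℝ := X 6
    let b₃ : MvPolynomial (Fin 8) ℝ := X 7
    let d : Fin 8 → MvPolynomial (Fin 8) ℝ :=
      ![A₃ ^ 2 + B₃ ^ 2,
        (A₃ - 1) ^ 2 + B₃ ^ 2,
        (a₂ - a₁) ^ 2 + (b₂ - b₁) ^ 2,
        (a₃ - a₁) ^ 2 + (b₃ - b₁) ^ 2,
        (a₃ - a₂) ^ 2 + (b₃ - b₂) ^ 2,
        a₁ ^ 2 + b₁ ^ 2,
        (a₂ - 1) ^ 2 + b₂ ^ 2,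
        (a₃ - A₃) ^ 2 + (b₃ - B₃) ^ 2]
    let J : Matrix (Fin 8) (Fin 8) (MvPolynomial (Fin 8) ℝ) :=
      Matrix.of fun i j => pderiv i (d j)
    let s₁ : MvPolynomial (Fin 8) ℝ := B₃
    let s₂ : MvPolynomial (Fin 8) ℝ :=
      a₁ * b₂ - a₁ * b₃ - a₂ * b₁ + a₂ * b₃ + a₃ * b₁ - a₃ * b₂
    let s₃ : MvPolynomial (Fin 8) ℝ :=
      A₃ * a₁ * b₂ * b₃ - A₃ * a₂ * b₁ * b₃ - B₃ * a₁ * a₃ * b₂ +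
        B₃ * a₂ * a₃ * b₁ - A₃ * b₁ * b₂ + A₃ * b₁ * b₃ + B₃ * a₁ * b₂ -
        B₃ * a₃ * b₁ - a₁ * b₂ * b₃ + a₃ * b₁ * b₂
    ∃ c : ℚ, c ≠ 0 ∧ J.det = C (c : ℝ) * (s₁ * s₂ * s₃) := by
  intro A₃ B₃ a₁ b₁ a₂ b₂ a₃ b₃ d J s₁ s₂ s₃
  have hJ : J =
      !![2 * A₃, 2 * (A₃ - 1), 0, 0, 0, 0, 0, 2 * (A₃ - a₃);
        2 * B₃, 2 * B₃, 0, 0, 0, 0, 0, 2 * (B₃ - b₃);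
        0, 0, 2 * (a₁ - a₂), 2 * (a₁ - a₃), 0, 2 * a₁, 0, 0;
        0, 0, 2 * (b₁ - b₂), 2 * (b₁ - b₃), 0, 2 * b₁, 0, 0;
        0, 0, 2 * (a₂ - a₁), 0, 2 * (a₂ - a₃), 0, 2 * (a₂ - 1), 0;
        0, 0, 2 * (b₂ - b₁), 0, 2 * (b₂ - b₃), 0, 2 * b₂, 0;
        0, 0, 0, 2 * (a₃ - a₁), 2 * (a₃ - a₂), 0, 0, 2 * (a₃ - A₃);
        0, 0, 0, 2 * (b₃ - b₁), 2 * (b₃ - b₂), 0, 0, 2 * (b₃ - B₃)] := by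
    ext1 i j
    fin_cases i <;> fin_cases j <;>
      simp [J, d, A₃, B₃, a₁, b₁, a₂, b₂, a₃, b₃, pderiv_X]
  refine ⟨256, by norm_num, ?_⟩
  rw [hJ, det_threeRPR_rigidity, Rat.cast_ofNat, map_ofNat]
end
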